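/- Let d₀ ≤ d₁ ≤ d₂ ≤ d₃ be non-negative integers of the same parity and let X → ℙ² be a very general complex projective quadric surface bundle of type (d₀, d₁, d₂, d₃). If d₁ = 0 (equivalently d₀ = d₁ = 0), then X → ℙ² admits a section, and hence X is rational. If d₀ = d₁ = d₂ = d₃ = 1, then X is a hypersurface of bidegree (1, 2) in ℙ² × ℙ³ and projection to the second factor shows that X is rational. In particular, X is rational whenever d₀ + d₁ + d₂ + d₃ ≤ 4 or d_i = d_j = 0 for some i ≠ j. -/

import Mathlib

/-!
Rationality, stable rationality and stable birationality, expressed via function fields: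
a variety `X` over `k` with function field `F` (a `k`-algebra via `c : k →+* F`) is rational
iff `F ≅ k(t₁,…,t_n)` over `k`, and stably rational iff `F(t₁,…,t_m) ≅ k(t₁,…,t_n)` over `k`
for some `m, n`. Two varieties are stably birational iff their function fields become
isomorphic after adjoining finitely many indeterminates.
-/

noncomputable section

/-- The rational function field `k(t₁, …, t_n)`. -/
def ratFuncField (k : Type) [Field k] (n : ℕ) : Type :=
  FractionRing (MvPolynomial (Fin n) k)

instance (k : Type) [Field k] (n : ℕ) : Field (ratFuncField k n) := by
  unfold ratFuncField; infer_instance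

/-- The canonical map `k → k(t₁, …, t_n)`. -/
def ratFuncFieldMap (k : Type) [Field k] (n : ℕ) : k →+* ratFuncField k n :=
  (algebraMap (MvPolynomial (Fin n) k) (FractionRing (MvPolynomial (Fin n) k))).comp
    (MvPolynomial.C)

/-- Given a function field `F` over `k` (via `c : k →+* F`), the canonical map
`k → Frac(F[t₁,…,t_m]) = F(t₁,…,t_m)`. -/
def adjoinIndetsMap {k F : Type} [CommRing k] [CommRing F] (c : k →+* F) (m : ℕ) :
    k →+* FractionRing (MvPolynomial (Fin m) F) :=
  (algebraMap (MvPolynomial (Fin m) F) (FractionRing (MvPolynomial (Fin m) F))).comp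
    ((MvPolynomial.C).comp c)

/-- A variety over `k` with function field `F` (via `c : k →+* F`) is rational iff
`F ≅ k(t₁,…,t_n)` as `k`-algebras for some `n`. -/
def IsRationalFunctionField {k F : Type} [Field k] [CommRing F] (c : k →+* F) : Prop :=
  ∃ (n : ℕ) (e : F ≃+* ratFuncField k n), (e : F →+* ratFuncField k n).comp c =
    ratFuncFieldMap k n

/-- A variety over `k` with function field `F` (via `c : k →+* F`) is stably rational iff
`F(t₁,…,t_m) ≅ k(t₁,…,t_n)` as `k`-algebras for some `m, n`. -/
def IsStablyRationalFunctionField {k F : Type} [Field k] [CommRing F] (c : k →+* F) : Prop :=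
  ∃ (m n : ℕ) (e : FractionRing (MvPolynomial (Fin m) F) ≃+* ratFuncField k n),
    (e : FractionRing (MvPolynomial (Fin m) F) →+* ratFuncField k n).comp
      (adjoinIndetsMap c m) = ratFuncFieldMap k n

/-- Two varieties over `K` with function fields `L₁, L₂` (via `i₁ : K →+* L₁`,
`i₂ : K →+* L₂`) are stably birational over `K` iff `L₁(t₁,…,t_a) ≅ L₂(t₁,…,t_b)`
as `K`-algebras for some `a, b`. -/
def StablyBirationalOver {K L₁ L₂ : Type} [Field K] [CommRing L₁] [CommRing L₂]
    (i₁ : K →+* L₁) (i₂ : K →+* L₂) : Prop :=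
  ∃ (a b : ℕ) (e : FractionRing (MvPolynomial (Fin a) L₁) ≃+*
      FractionRing (MvPolynomial (Fin b) L₂)),
    (e : FractionRing (MvPolynomial (Fin a) L₁) →+*
      FractionRing (MvPolynomial (Fin b) L₂)).comp (adjoinIndetsMap i₁ a) =
      adjoinIndetsMap i₂ b

end

/-!
Very general members of linear families, and quadric surface bundles over `ℙ²` given by
symmetric matrices of homogeneous forms, described via affine charts and function fields.
-/

noncomputable section

/-- A polynomial function on a `ℂ`-vector space `P`: a function factoring through finitely
many linear coordinates via a polynomial. -/
def IsPolynomialFun {P : Type} [AddCommGroup P] [Module ℂ P] (f : P → ℂ) : Prop :=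
  ∃ (N : ℕ) (l : Fin N → (P →ₗ[ℂ] ℂ)) (F : MvPolynomial (Fin N) ℂ),
    ∀ p : P, f p = MvPolynomial.eval (fun i => l i p) F

/-- A property `Q` holds for a very general member of the linear parameter space `P` if it
holds away from a countable union of proper algebraic hypersurfaces, i.e. if there are
countably many nonzero polynomial functions on `P` such that `Q p` holds whenever none of
them vanishes at `p`. -/
def VeryGeneral {P : Type} [AddCommGroup P] [Module ℂ P] (Q : P → Prop) : Prop :=
  ∃ 𝒞 : Set (P → ℂ), 𝒞.Countable ∧ (∀ f ∈ 𝒞, IsPolynomialFun f ∧ f ≠ 0) ∧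
    ∀ p : P, (∀ f ∈ 𝒞, f p ≠ 0) → Q p

/-- Dehomogenization `ℂ[x,y,z] → ℂ[x,y] ⊆ ℂ[x,y,z₁,z₂,z₃]` at the chart `z = 1` of `ℙ²`
(the first two variables of `Fin 5` are the base coordinates). -/
def dehomP2 : MvPolynomial (Fin 3) ℂ →+* MvPolynomial (Fin 5) ℂ :=
  (MvPolynomial.aeval ![MvPolynomial.X 0, MvPolynomial.X 1, 1]).toRingHom

/-- Dehomogenization `ℂ[x,y,z] → ℂ[x,y]` at the chart `z = 1`. -/
def dehomP2' : MvPolynomial (Fin 3) ℂ →+* MvPolynomial (Fin 2) ℂ :=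
  (MvPolynomial.aeval ![MvPolynomial.X 0, MvPolynomial.X 1, 1]).toRingHom

/-- The defining polynomial `∑_{i,j} a_{ij}(x,y,1) z_i z_j` (with `z₀ = 1`) of the affine
chart of the quadric surface bundle `X = {∑ a_{ij} z_i z_j = 0} ⊆ ℙ(E)` over `ℙ²`. -/
def quadricBundleChartPoly (A : Fin 4 → Fin 4 → MvPolynomial (Fin 3) ℂ) :
    MvPolynomial (Fin 5) ℂ :=
  ∑ i : Fin 4, ∑ j : Fin 4, dehomP2 (A i j) *
    (![1, MvPolynomial.X 2, MvPolynomial.X 3, MvPolynomial.X 4] i) *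
    (![1, MvPolynomial.X 2, MvPolynomial.X 3, MvPolynomial.X 4] j)

/-- The coordinate ring of the affine chart (`z = 1` on `ℙ²` and `z₀ = 1` on the fibre)
of the quadric surface bundle `X ⊆ ℙ(E)` over `ℙ²` determined by the symmetric matrix
`(a_{ij})`. -/
def quadricBundleChartRing (A : Fin 4 → Fin 4 → MvPolynomial (Fin 3) ℂ) : Type :=
  MvPolynomial (Fin 5) ℂ ⧸ Ideal.span {quadricBundleChartPoly A}

instance (A : Fin 4 → Fin 4 → MvPolynomial (Fin 3) ℂ) :
    CommRing (quadricBundleChartRing A) :=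
  Ideal.Quotient.commRing _

/-- The function field `ℂ(X)` of the quadric surface bundle `X` over `ℙ²` given by the
matrix `(a_{ij})`, as the fraction ring of the affine chart. -/
def quadricBundleFunctionField (A : Fin 4 → Fin 4 → MvPolynomial (Fin 3) ℂ) : Type :=
  FractionRing (quadricBundleChartRing A)

instance (A : Fin 4 → Fin 4 → MvPolynomial (Fin 3) ℂ) :
    CommRing (quadricBundleFunctionField A) := by
  unfold quadricBundleFunctionField; infer_instance

/-- The canonical map `ℂ → ℂ(X)`. -/
def quadricBundleFFMap (A : Fin 4 → Fin 4 → MvPolynomial (Fin 3) ℂ) :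
    ℂ →+* quadricBundleFunctionField A :=
  (algebraMap (quadricBundleChartRing A) (FractionRing (quadricBundleChartRing A))).comp
    ((Ideal.Quotient.mk _).comp (MvPolynomial.C))

/-- The conditions for the symmetric matrix `(a_{ij})` of forms to define a quadric surface
bundle over `ℙ²`: the quadratic form is generically nondegenerate, and nonzero on every
fibre (so that `X → ℙ²` is flat). Homogeneity of the `a_{ij}` of the correct degrees is
part of the choice of parameter space. -/
def IsQuadricBundleP2 (A : Fin 4 → Fin 4 → MvPolynomial (Fin 3) ℂ) : Prop :=
  Matrix.det (Matrix.of fun i j => A i j + A j i) ≠ 0 ∧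
  ∀ v : Fin 3 → ℂ, v ≠ 0 → ∃ i j, MvPolynomial.eval v (A i j + A j i) ≠ 0

/-- The quadric surface bundle over `ℙ²` given by `(a_{ij})` admits a rational section:
there are rational functions `σ₀, …, σ₃` on `ℙ²`, not all zero, with
`∑ a_{ij} σ_i σ_j = 0`. -/
def HasRationalSectionP2 (A : Fin 4 → Fin 4 → MvPolynomial (Fin 3) ℂ) : Prop :=
  ∃ σ : Fin 4 → FractionRing (MvPolynomial (Fin 2) ℂ), σ ≠ 0 ∧
    ∑ i : Fin 4, ∑ j : Fin 4,
      (algebraMap (MvPolynomial (Fin 2) ℂ) (FractionRing (MvPolynomial (Fin 2) ℂ)))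
        (dehomP2' (A i j)) * σ i * σ j = 0

end

/-- A field generated over `k` by as many elements as an algebraically independent family
of size `n` is a rational function field. -/
theorem isRationalFunctionField_of_adjoin_eq_top {k L : Type} [Field k] [Field L] [Algebra k L]
    {n : ℕ} {s : Fin n → L} (hs : AlgebraicIndependent k s) {t : Fin n → L}
    (ht : IntermediateField.adjoin k (Set.range t) = ⊤) :
    IsRationalFunctionField (algebraMap k L) := by
  have halg : Algebra.IsAlgebraic (Algebra.adjoin k (Set.range t)) L := by
    rw [← IntermediateField.isAlgebraic_adjoin_iff_top, ht]
    exact ⟨fun x => isAlgebraic_algebraMap (⟨x, trivial⟩ : (⊤ : IntermediateField k L))⟩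
  have htb : IsTranscendenceBasis k t :=
    Algebra.IsAlgebraic.isTranscendenceBasis_of_le_trdeg_of_finite k t hs.cardinalMk_le_trdeg
  let e : FractionRing (MvPolynomial (Fin n) k) ≃ₐ[k] L :=
    (htb.1.aevalEquivField.trans (IntermediateField.equivOfEq ht)).trans
      IntermediateField.topEquiv
  refine ⟨n, e.symm.toRingEquiv, ?_⟩
  ext x
  have : e.symm (algebraMap k L x) = algebraMap k _ x := e.symm.commutes x
  refine this.trans ?_
  rw [IsScalarTower.algebraMap_apply k (MvPolynomial (Fin n) k)]
  rfl

theorem aeval_mem_intermediateField {σ k L : Type*} [Field k] [Field L] [Algebra k L]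
    {K : IntermediateField k L} {s : σ → L} (hs : ∀ j, s j ∈ K) (g : MvPolynomial σ k) :
    MvPolynomial.aeval s g ∈ K := by
  have : MvPolynomial.aeval s g ∈ Algebra.adjoin k (Set.range s) := by
    rw [Algebra.adjoin_range_eq_range_aeval]
    exact ⟨g, rfl⟩
  exact Algebra.adjoin_le (S := K.toSubalgebra) (Set.range_subset_iff.2 hs) this

namespace QuadricBundle

open MvPolynomial

/-- The function field of the affine hypersurface `q = 0`. -/
abbrev HypersurfaceField (q : MvPolynomial (Fin 5) ℂ) : Type :=
  FractionRing (MvPolynomial (Fin 5) ℂ ⧸ Ideal.span {q})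

instance (q : MvPolynomial (Fin 5) ℂ) [h : Fact (Irreducible q)] :
    IsDomain (MvPolynomial (Fin 5) ℂ ⧸ Ideal.span {q}) :=
  (Ideal.Quotient.isDomain_iff_prime _).2
    ((Ideal.span_singleton_prime h.out.ne_zero).2 h.out.prime)

/-- The coordinate functions on the hypersurface `q = 0`. -/
noncomputable def coordFun (q : MvPolynomial (Fin 5) ℂ) (j : Fin 5) : HypersurfaceField q :=
  algebraMap _ _ (Ideal.Quotient.mk (Ideal.span {q}) (X j))

theorem aeval_coordFun (q g : MvPolynomial (Fin 5) ℂ) :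
    aeval (coordFun q) g = algebraMap _ _ (Ideal.Quotient.mk (Ideal.span {q}) g) := by
  have : aeval (coordFun q) =
      (IsScalarTower.toAlgHom ℂ _ (HypersurfaceField q)).comp
        (Ideal.Quotient.mkₐ ℂ (Ideal.span {q})) := by
    ext j
    simp [coordFun]
  rw [this]
  rfl

theorem aeval_coordFun_eq_zero {q g : MvPolynomial (Fin 5) ℂ} :
    aeval (coordFun q) g = 0 ↔ q ∣ g := by
  rw [aeval_coordFun, FaithfulSMul.algebraMap_eq_zero_iff, Ideal.Quotient.eq_zero_iff_mem,
    Ideal.mem_span_singleton]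

/-- If the irreducible polynomial `q` involves a variable, then the hypersurface `q = 0` is
rational as soon as its function field is generated by four elements. -/
theorem isRationalFunctionField_hypersurface (q : MvPolynomial (Fin 5) ℂ) [Fact (Irreducible q)]
    (e : MvPolynomial (Fin 5) ℂ ≃ₐ[ℂ] Polynomial (MvPolynomial (Fin 4) ℂ)) (ι : Fin 4 → Fin 5)
    (he : ∀ j, e (X (ι j)) = Polynomial.C (X j)) (hq : (e q).natDegree ≠ 0)
    (t : Fin 4 → HypersurfaceField q)
    (ht : ∀ j, coordFun q j ∈ IntermediateField.adjoin ℂ (Set.range t)) :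
    IsRationalFunctionField (algebraMap ℂ (HypersurfaceField q)) := by
  have he' (g : MvPolynomial (Fin 4) ℂ) : e (rename ι g) = Polynomial.C g := by
    have : (e : _ →ₐ[ℂ] _).comp (rename ι) =
        IsScalarTower.toAlgHom ℂ _ (Polynomial (MvPolynomial (Fin 4) ℂ)) := by
      ext j : 1
      simp [he]
    exact DFunLike.congr_fun this g
  have hs : AlgebraicIndependent ℂ (fun j => coordFun q (ι j)) := by
    rw [algebraicIndependent_iff]
    intro g hg
    have h1 : aeval (coordFun q) (rename ι g) = 0 := by rw [aeval_rename]; exact hg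
    rw [aeval_coordFun_eq_zero] at h1
    have h2 := map_dvd e h1
    rw [he'] at h2
    by_contra hne
    have := Polynomial.natDegree_le_of_dvd h2 (Polynomial.C_ne_zero.2 hne)
    rw [Polynomial.natDegree_C] at this
    omega
  refine isRationalFunctionField_of_adjoin_eq_top hs (t := t) ?_
  rw [eq_top_iff]
  rintro x -
  obtain ⟨a, b, hb, rfl⟩ := IsFractionRing.div_surjective
    (A := MvPolynomial (Fin 5) ℂ ⧸ Ideal.span {q}) x
  have hmem (c : MvPolynomial (Fin 5) ℂ ⧸ Ideal.span {q}) :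
      algebraMap _ (HypersurfaceField q) c ∈ IntermediateField.adjoin ℂ (Set.range t) := by
    obtain ⟨g, rfl⟩ := Ideal.Quotient.mk_surjective c
    rw [← aeval_coordFun]
    exact aeval_mem_intermediateField ht g
  exact div_mem (hmem a) (hmem b)

theorem isRationalFunctionField_quadricBundleFFMap
    {A : Fin 4 → Fin 4 → MvPolynomial (Fin 3) ℂ}
    (h : IsRationalFunctionField
      (algebraMap ℂ (HypersurfaceField (quadricBundleChartPoly A)))) :
    IsRationalFunctionField (quadricBundleFFMap A) := by
  obtain ⟨n, f, hf⟩ := h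
  refine ⟨n, f, ?_⟩
  rw [← hf]
  rfl

/-- A quadratic polynomial in one variable over a domain, with invertible leading coefficient and
without roots, is irreducible. -/
theorem irreducible_quadratic {R : Type*} [CommRing R] [IsDomain R] {u β γ : R} (hu : IsUnit u)
    (h : ∀ s, u * s ^ 2 + β * s + γ ≠ 0) :
    Irreducible (Polynomial.C u * Polynomial.X ^ 2 + Polynomial.C β * Polynomial.X +
      Polynomial.C γ) := by
  obtain ⟨v, hv⟩ := hu.exists_left_inv
  have hvu : IsUnit (Polynomial.C v) := Polynomial.isUnit_C.2 (.of_mul_eq_one u hv)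
  rw [← irreducible_isUnit_mul hvu]
  have key : Polynomial.C v * (Polynomial.C u * Polynomial.X ^ 2 + Polynomial.C β * Polynomial.X +
      Polynomial.C γ) =
      Polynomial.C 1 * Polynomial.X ^ 2 + Polynomial.C (v * β) * Polynomial.X +
        Polynomial.C (v * γ) := by
    rw [← hv]
    simp only [map_mul]
    ring
  have hdeg := Polynomial.natDegree_quadratic (b := v * β) (c := v * γ) (one_ne_zero (α := R))
  have hlead := Polynomial.leadingCoeff_quadratic (b := v * β) (c := v * γ)
    (one_ne_zero (α := R))
  rw [key, Polynomial.Monic.irreducible_iff_roots_eq_zero_of_degree_le_three hlead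
    (by omega) (by omega), Multiset.eq_zero_iff_forall_notMem]
  intro s hs
  have hs := Polynomial.isRoot_of_mem_roots hs
  simp only [map_one, one_mul, Polynomial.IsRoot.def, Polynomial.eval_add, Polynomial.eval_mul,
    Polynomial.eval_pow, Polynomial.eval_C, Polynomial.eval_X] at hs
  apply h s
  linear_combination u * hs - (β * s + γ) * hv

/-- The determinant of the leading `3 × 3` block of a symmetric matrix. -/
def leadingMinor (M : Fin 4 → Fin 4 → ℂ) : ℂ :=
  M 0 0 * (M 1 1 * M 2 2 - M 1 2 ^ 2) - M 0 1 * (M 0 1 * M 2 2 - M 1 2 * M 0 2) +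
    M 0 2 * (M 0 1 * M 1 2 - M 1 1 * M 0 2)

theorem sq_coeff_relation {w : Polynomial ℂ} {e₀ e₁ e₂ : ℂ}
    (h : w ^ 2 = Polynomial.C e₂ * Polynomial.X ^ 2 + Polynomial.C e₁ * Polynomial.X +
      Polynomial.C e₀) :
    e₁ ^ 2 = 4 * e₀ * e₂ := by
  have hw : w.natDegree ≤ 1 := by
    have h1 : (w ^ 2).natDegree ≤ 2 := h ▸ Polynomial.natDegree_quadratic_le
    rw [Polynomial.natDegree_pow] at h1
    omega
  obtain ⟨a, b, rfl⟩ := Polynomial.exists_eq_X_add_C_of_natDegree_le_one hw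
  have h' : Polynomial.C (a ^ 2) * Polynomial.X ^ 2 + Polynomial.C (2 * a * b) * Polynomial.X +
      Polynomial.C (b ^ 2) = Polynomial.C e₂ * Polynomial.X ^ 2 + Polynomial.C e₁ * Polynomial.X +
      Polynomial.C e₀ := by
    rw [← h]
    simp only [map_mul, map_pow, map_ofNat]
    ring
  have c0 := congrArg (Polynomial.coeff · 0) h'
  have c1 := congrArg (Polynomial.coeff · 1) h'
  have c2 := congrArg (Polynomial.coeff · 2) h'
  simp only [Polynomial.coeff_add, Polynomial.coeff_C_mul, Polynomial.coeff_X_pow,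
    Polynomial.coeff_X, Polynomial.coeff_C] at c0 c1 c2
  norm_num at c0 c1 c2
  rw [← c0, ← c1, ← c2]
  ring

/-- `ℂ[x, y, z₁, z₂, z₃]` as a polynomial ring in the fibre coordinate `z₁`. -/
noncomputable def fibreEquiv :
    MvPolynomial (Fin 5) ℂ ≃ₐ[ℂ] Polynomial (MvPolynomial (Fin 4) ℂ) :=
  (renameEquiv ℂ (Equiv.swap 0 2)).trans (finSuccEquiv ℂ 4)

theorem fibreEquiv_X (i : Fin 5) :
    fibreEquiv (X i) = (![Polynomial.C (X 1), Polynomial.C (X 0), Polynomial.X,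
      Polynomial.C (X 2), Polynomial.C (X 3)] : Fin 5 → Polynomial (MvPolynomial (Fin 4) ℂ)) i := by
  have h : fibreEquiv (X i) = finSuccEquiv ℂ 4 (X (Equiv.swap 0 2 i)) := by
    simp [fibreEquiv]
  have hs (j : Fin 4) : finSuccEquiv ℂ 4 (X j.succ) = Polynomial.C (X j) := finSuccEquiv_X_succ
  rw [h]
  fin_cases i
  · rw [show Equiv.swap (0 : Fin 5) 2 ((fun i => i) ⟨0, by decide⟩) = Fin.succ 1 by decide, hs]
    rfl
  · rw [show Equiv.swap (0 : Fin 5) 2 ((fun i => i) ⟨1, by decide⟩) = Fin.succ 0 by decide, hs]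
    rfl
  · rw [show Equiv.swap (0 : Fin 5) 2 ((fun i => i) ⟨2, by decide⟩) = 0 by decide,
      finSuccEquiv_X_zero]
    rfl
  · rw [show Equiv.swap (0 : Fin 5) 2 ((fun i => i) ⟨3, by decide⟩) = Fin.succ 2 by decide, hs]
    rfl
  · rw [show Equiv.swap (0 : Fin 5) 2 ((fun i => i) ⟨4, by decide⟩) = Fin.succ 3 by decide, hs]
    rfl

/-- Dehomogenization into the coefficient ring of `fibreEquiv`. -/
noncomputable def dehomCoeff : MvPolynomial (Fin 3) ℂ →ₐ[ℂ] MvPolynomial (Fin 4) ℂ :=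
  aeval ![X 1, X 0, 1]

theorem fibreEquiv_dehomP2 (p : MvPolynomial (Fin 3) ℂ) :
    fibreEquiv (dehomP2 p) = Polynomial.C (dehomCoeff p) := by
  have : (fibreEquiv : MvPolynomial (Fin 5) ℂ →ₐ[ℂ] _).comp (aeval ![X 0, X 1, 1]) =
      (IsScalarTower.toAlgHom ℂ _ (Polynomial (MvPolynomial (Fin 4) ℂ))).comp dehomCoeff := by
    ext j : 1
    fin_cases j <;> simp [fibreEquiv_X, dehomCoeff]
  exact DFunLike.congr_fun this p

theorem fibreEquiv_quadricBundleChartPoly (A : Fin 4 → Fin 4 → MvPolynomial (Fin 3) ℂ) :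
    fibreEquiv (quadricBundleChartPoly A) =
      Polynomial.C (dehomCoeff (A 1 1)) * Polynomial.X ^ 2 +
      Polynomial.C (dehomCoeff (A 0 1 + A 1 0) + dehomCoeff (A 1 2 + A 2 1) * X 2 +
        dehomCoeff (A 1 3 + A 3 1) * X 3) * Polynomial.X +
      Polynomial.C (dehomCoeff (A 0 0) + dehomCoeff (A 0 2 + A 2 0) * X 2 +
        dehomCoeff (A 0 3 + A 3 0) * X 3 + dehomCoeff (A 2 2) * X 2 ^ 2 +
        dehomCoeff (A 2 3 + A 3 2) * X 2 * X 3 + dehomCoeff (A 3 3) * X 3 ^ 2) := by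
  simp only [quadricBundleChartPoly, Fin.sum_univ_four, map_add, map_mul, fibreEquiv_dehomP2,
    Matrix.cons_val, map_one, fibreEquiv_X, map_pow]
  ring

/-- The value at `v` of the symmetrization of `A`. -/
noncomputable def symmEval (v : Fin 3 → ℂ) (A : Fin 4 → Fin 4 → MvPolynomial (Fin 3) ℂ) :
    Fin 4 → Fin 4 → ℂ :=
  fun i j => eval v (A i j + A j i)

theorem irreducible_quadricBundleChartPoly {A : Fin 4 → Fin 4 → MvPolynomial (Fin 3) ℂ} {c : ℂ}
    (hc : c ≠ 0) (h11 : A 1 1 = C c) (hA : leadingMinor (symmEval ![0, 0, 1] A) ≠ 0) :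
    Irreducible (quadricBundleChartPoly A) := by
  rw [← MulEquiv.irreducible_iff fibreEquiv, fibreEquiv_quadricBundleChartPoly, h11]
  have hcC : dehomCoeff (C c) = C c := dehomCoeff.commutes c
  rw [hcC]
  refine irreducible_quadratic ((isUnit_iff_ne_zero.2 hc).map C) fun s hs => hA ?_
  let π : MvPolynomial (Fin 4) ℂ →ₐ[ℂ] Polynomial ℂ := aeval ![0, 0, Polynomial.X, 0]
  have hπ (p : MvPolynomial (Fin 3) ℂ) : π (dehomCoeff p) = Polynomial.C (eval ![0, 0, 1] p) := by
    have : π.comp dehomCoeff =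
        (IsScalarTower.toAlgHom ℂ ℂ (Polynomial ℂ)).comp (aeval ![0, 0, 1]) := by
      ext j : 1
      fin_cases j <;> simp [π, dehomCoeff]
    simpa [aeval_eq_eval] using DFunLike.congr_fun this p
  have hs := congrArg π hs
  have hX2 : π (X 2) = Polynomial.X := by simp [π]
  have hX3 : π (X 3) = 0 := by simp [π]
  have hC : π (C c) = Polynomial.C c := π.commutes c
  simp only [map_add, map_mul, map_pow, hπ, hX2, hX3, hC, map_zero] at hs
  set a : MvPolynomial (Fin 3) ℂ →+* ℂ := eval ![0, 0, 1] with ha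
  have hrel := sq_coeff_relation (w := 2 * Polynomial.C c * π s +
      Polynomial.C (a (A 0 1 + A 1 0)) + Polynomial.C (a (A 1 2 + A 2 1)) * Polynomial.X)
    (e₀ := a (A 0 1 + A 1 0) ^ 2 - 4 * c * a (A 0 0))
    (e₁ := 2 * a (A 0 1 + A 1 0) * a (A 1 2 + A 2 1) - 4 * c * a (A 0 2 + A 2 0))
    (e₂ := a (A 1 2 + A 2 1) ^ 2 - 4 * c * a (A 2 2)) (by
      simp only [map_add, map_sub, map_mul, map_pow, map_ofNat]
      linear_combination 4 * Polynomial.C c * hs)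
  have hac : a (A 1 1) = c := by simp [h11, a]
  have h0 : c * leadingMinor (symmEval ![0, 0, 1] A) = 0 := by
    simp only [leadingMinor, symmEval, map_add] at hrel ⊢
    rw [← ha, hac]
    linear_combination -(1 / 8 : ℂ) * hrel
  exact (mul_eq_zero.1 h0).resolve_left hc

theorem aeval_dehomP2 {S : Type*} [CommRing S] [Algebra ℂ S] (s : Fin 5 → S)
    (p : MvPolynomial (Fin 3) ℂ) :
    aeval s (dehomP2 p) = aeval ![s 0, s 1, 1] p := by
  have : (aeval s).comp (aeval ![X 0, X 1, 1]) =
      (aeval ![s 0, s 1, 1] : MvPolynomial (Fin 3) ℂ →ₐ[ℂ] S) := by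
    ext j
    fin_cases j <;> simp
  exact DFunLike.congr_fun this p

theorem natDegree_fibreEquiv_quadricBundleChartPoly
    {A : Fin 4 → Fin 4 → MvPolynomial (Fin 3) ℂ} {c : ℂ} (hc : c ≠ 0) (h11 : A 1 1 = C c) :
    (fibreEquiv (quadricBundleChartPoly A)).natDegree = 2 := by
  rw [fibreEquiv_quadricBundleChartPoly, h11, show dehomCoeff (C c) = C c from dehomCoeff.commutes c]
  exact Polynomial.natDegree_quadratic (C_ne_zero.2 hc)

set_option maxHeartbeats 1000000 in
/-- If the restriction of the quadratic form to the first two coordinates is constant, then the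
quadric bundle is rational: project from a constant isotropic vector. -/
theorem isRationalFunctionField_of_constant {A : Fin 4 → Fin 4 → MvPolynomial (Fin 3) ℂ}
    {a b c r : ℂ} (hc : c ≠ 0) (h00 : A 0 0 = C a) (h01 : A 0 1 + A 1 0 = C b) (h11 : A 1 1 = C c)
    (hr : c * r ^ 2 + b * r + a = 0) (hA : leadingMinor (symmEval ![0, 0, 1] A) ≠ 0) :
    IsRationalFunctionField (quadricBundleFFMap A) := by
  apply isRationalFunctionField_quadricBundleFFMap
  set q := quadricBundleChartPoly A with hq
  have hdeg : (fibreEquiv q).natDegree = 2 :=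
    natDegree_fibreEquiv_quadricBundleChartPoly hc h11
  have : Fact (Irreducible q) := ⟨irreducible_quadricBundleChartPoly hc h11 hA⟩
  set ξ := coordFun q with hξ
  have hvanish {f : MvPolynomial (Fin 5) ℂ} {u v : MvPolynomial (Fin 4) ℂ}
      (h : fibreEquiv f = Polynomial.C u * Polynomial.X + Polynomial.C v)
      (hf : aeval ξ f = 0) : f = 0 := by
    by_contra hne
    have hdvd := map_dvd fibreEquiv (aeval_coordFun_eq_zero.1 hf)
    have h1 := Polynomial.natDegree_le_of_dvd hdvd (by simpa using hne)
    have h2 : (fibreEquiv f).natDegree ≤ 1 := h ▸ Polynomial.natDegree_linear_le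
    omega
  have hCr (z : ℂ) : fibreEquiv (C z) = Polynomial.C (C z) := fibreEquiv.commutes z
  have hX := fibreEquiv_X
  have hw : ξ 2 - algebraMap ℂ _ r ≠ 0 := by
    intro h0
    have := hvanish (f := X 2 - C r) (u := 1) (v := -C r)
      (by rw [map_sub, hCr, hX]; simp [sub_eq_add_neg]) (by simpa using h0)
    have := congrArg (aeval (fun _ => r + 1)) this
    simp at this
  set D : MvPolynomial (Fin 3) ℂ →ₐ[ℂ] HypersurfaceField q := aeval ![ξ 0, ξ 1, 1] with hD
  set ρ := algebraMap ℂ (HypersurfaceField q) r with hρ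
  set w := ξ 2 - ρ with hwdef
  set t : Fin 4 → HypersurfaceField q := ![ξ 0, ξ 1, ξ 3 / w, ξ 4 / w] with ht
  set K := IntermediateField.adjoin ℂ (Set.range t) with hK
  have htK (i : Fin 4) : t i ∈ K := IntermediateField.subset_adjoin _ _ ⟨i, rfl⟩
  have hDK (p : MvPolynomial (Fin 3) ℂ) : D p ∈ K := by
    refine aeval_mem_intermediateField (fun j => ?_) p
    fin_cases j
    exacts [htK 0, htK 1, one_mem K]
  have hcK (z : ℂ) : algebraMap ℂ (HypersurfaceField q) z ∈ K := K.algebraMap_mem z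
  set l₂ := A 0 2 + A 2 0 + C r * (A 1 2 + A 2 1) with hl₂
  set l₃ := A 0 3 + A 3 0 + C r * (A 1 3 + A 3 1) with hl₃
  set β := b + 2 * c * r with hβ
  set u := ξ 3 / w with hu
  set v := ξ 4 / w with hv
  have huK : u ∈ K := htK 2
  have hvK : v ∈ K := htK 3
  have h3 : ξ 3 = u * w := (div_mul_cancel₀ _ hw).symm
  have h4 : ξ 4 = v * w := (div_mul_cancel₀ _ hw).symm
  have h2 : ξ 2 = w + ρ := (sub_add_cancel _ _).symm
  set lin := algebraMap ℂ _ β + D l₂ * u + D l₃ * v with hlin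
  set quad := algebraMap ℂ _ c + D (A 1 2 + A 2 1) * u + D (A 1 3 + A 3 1) * v +
    D (A 2 2) * u ^ 2 + D (A 2 3 + A 3 2) * u * v + D (A 3 3) * v ^ 2 with hquad
  have hlinK : lin ∈ K :=
    add_mem (add_mem (hcK _) (mul_mem (hDK _) huK)) (mul_mem (hDK _) hvK)
  have hquadK : quad ∈ K :=
    add_mem (add_mem (add_mem (add_mem (add_mem (hcK _) (mul_mem (hDK _) huK))
      (mul_mem (hDK _) hvK)) (mul_mem (hDK _) (pow_mem huK 2)))
      (mul_mem (mul_mem (hDK _) huK) hvK)) (mul_mem (hDK _) (pow_mem hvK 2))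
  have hDC (z : ℂ) : D (C z) = algebraMap ℂ _ z := D.commutes z
  have hrel : w * (lin + w * quad) = 0 := by
    have h0 : aeval ξ q = 0 := aeval_coordFun_eq_zero.2 dvd_rfl
    simp only [hq, quadricBundleChartPoly, Fin.sum_univ_four, map_add, map_mul, aeval_dehomP2,
      Matrix.cons_val, map_one, aeval_X] at h0
    rw [← hD, h2, h3, h4, h00, h11, hDC, hDC] at h0
    have h01' := congrArg D h01
    rw [map_add, hDC] at h01'
    have hr' := congrArg (algebraMap ℂ (HypersurfaceField q)) hr
    simp only [map_add, map_mul, map_pow, map_zero] at hr'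
    simp only [hlin, hquad, hl₂, hl₃, hβ, map_add, map_mul, map_ofNat, hDC, ← hρ] at hr' ⊢
    linear_combination h0 - hr' - (w + ρ) * h01'
  have hsum : lin + w * quad = 0 := (mul_eq_zero.1 hrel).resolve_left hw
  have hquad0 : quad ≠ 0 := by
    intro h0
    have hlin0 : lin = 0 := by rw [h0, mul_zero, add_zero] at hsum; exact hsum
    have hf := hvanish (f := C β * (X 2 - C r) + dehomP2 l₂ * X 3 + dehomP2 l₃ * X 4)
      (u := C β) (v := -(C β * C r) + dehomCoeff l₂ * X 2 + dehomCoeff l₃ * X 3)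
      (by
        simp only [map_add, map_mul, map_sub, map_neg, hCr, hX, fibreEquiv_dehomP2,
          Matrix.cons_val]
        ring)
      (by
        simp only [map_add, map_mul, map_sub, aeval_X, aeval_C, aeval_dehomP2]
        rw [← hD, ← hρ, ← hwdef, h3, h4]
        linear_combination w * hlin0)
    have e1 := congrArg (aeval ![0, 0, r + 1, 0, 0]) hf
    have e2 := congrArg (aeval ![0, 0, r, 1, 0]) hf
    simp only [map_add, map_mul, map_sub, aeval_X, aeval_C, aeval_dehomP2, Matrix.cons_val,
      Algebra.algebraMap_self, RingHom.id_apply, map_zero] at e1 e2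
    apply hA
    have hb := congrArg (eval ![0, 0, 1]) h01
    simp only [map_add, eval_C] at hb
    simp only [hl₂, map_add, map_mul, aeval_eq_eval, Algebra.algebraMap_self, RingHom.id_apply, aeval_C] at e2
    have hbr : b = -(2 * c * r) := by linear_combination e1
    have har : a = c * r ^ 2 := by linear_combination hr - r * hbr
    have hl : eval ![0, 0, 1] (A 0 2) + eval ![0, 0, 1] (A 2 0) =
        -(r * (eval ![0, 0, 1] (A 1 2) + eval ![0, 0, 1] (A 2 1))) := by
      linear_combination e2
    simp only [leadingMinor, symmEval, h00, h11, map_add, eval_C, hb, hl]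
    rw [har, hbr]
    ring
  have hwK : w ∈ K := by
    have : w = -lin / quad := eq_div_of_mul_eq hquad0 (by linear_combination hsum)
    rw [this]
    exact div_mem (neg_mem hlinK) hquadK
  refine isRationalFunctionField_hypersurface q fibreEquiv ![1, 0, 3, 4] (fun j => ?_)
    (by omega) t (fun j => ?_)
  · fin_cases j <;> exact fibreEquiv_X _
  · change ξ j ∈ K
    fin_cases j
    · exact htK 0
    · exact htK 1
    · change ξ 2 ∈ K
      rw [h2]
      exact add_mem hwK (hcK r)
    · change ξ 3 ∈ K
      rw [h3]
      exact mul_mem huK hwK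
    · change ξ 4 ∈ K
      rw [h4]
      exact mul_mem hvK hwK

theorem eq_C_of_isHomogeneous_zero {σ : Type*} {p : MvPolynomial σ ℂ} (hp : p.IsHomogeneous 0) :
    ∃ a, p = C a :=
  ⟨_, totalDegree_eq_zero_iff_eq_C.1 ((totalDegree_zero_iff_isHomogeneous σ).2 hp)⟩

theorem eq_of_isHomogeneous_one {p : MvPolynomial (Fin 3) ℂ} (hp : p.IsHomogeneous 1) :
    p = C (eval ![1, 0, 0] p) * X 0 + C (eval ![0, 1, 0] p) * X 1 +
      C (eval ![0, 0, 1] p) * X 2 := by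
  have h (i : Fin 3) : ∃ a, pderiv i p = C a := eq_C_of_isHomogeneous_zero hp.pderiv
  choose a ha using h
  have h := hp.sum_X_mul_pderiv
  simp only [Fin.sum_univ_three, ha, one_smul] at h
  rw [← h]
  simp
  ring

/-- The value of the matrix of forms `A` at `v`, as a matrix of constant polynomials. -/
noncomputable def constMatrix (v : Fin 3 → ℂ) (A : Fin 4 → Fin 4 → MvPolynomial (Fin 3) ℂ) :
    Fin 4 → Fin 4 → MvPolynomial (Fin 3) ℂ :=
  fun i j => C (eval v (A i j))

theorem symmEval_constMatrix (u v : Fin 3 → ℂ) (A : Fin 4 → Fin 4 → MvPolynomial (Fin 3) ℂ) :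
    symmEval u (constMatrix v A) = symmEval v A := by
  ext i j
  simp [symmEval, constMatrix]

theorem quadricBundleChartPoly_of_linear {A : Fin 4 → Fin 4 → MvPolynomial (Fin 3) ℂ}
    (hA : ∀ i j, (A i j).IsHomogeneous 1) :
    quadricBundleChartPoly A =
      quadricBundleChartPoly (constMatrix ![1, 0, 0] A) * X 0 +
        (quadricBundleChartPoly (constMatrix ![0, 1, 0] A) * X 1 +
          quadricBundleChartPoly (constMatrix ![0, 0, 1] A)) := by
  have hD (i j : Fin 4) : dehomP2 (A i j) = dehomP2 (constMatrix ![1, 0, 0] A i j) * X 0 +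
      (dehomP2 (constMatrix ![0, 1, 0] A i j) * X 1 + dehomP2 (constMatrix ![0, 0, 1] A i j)) := by
    conv_lhs => rw [eq_of_isHomogeneous_one (hA i j)]
    simp [dehomP2, constMatrix, add_assoc]
  simp only [quadricBundleChartPoly, hD, Finset.sum_mul, ← Finset.sum_add_distrib]
  exact Finset.sum_congr rfl fun i _ => Finset.sum_congr rfl fun j _ => by ring

/-- The fibre of the quadric bundle over the point `v`, in the fibre coordinates. -/
noncomputable def fibrePoly (v : Fin 3 → ℂ) (A : Fin 4 → Fin 4 → MvPolynomial (Fin 3) ℂ) :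
    MvPolynomial (Fin 4) ℂ :=
  ∑ i, ∑ j, C (eval v (A i j)) * (![1, X 1, X 2, X 3] i) * (![1, X 1, X 2, X 3] j)

theorem finSuccEquiv_quadricBundleChartPoly_constMatrix (v : Fin 3 → ℂ)
    (A : Fin 4 → Fin 4 → MvPolynomial (Fin 3) ℂ) :
    finSuccEquiv ℂ 4 (quadricBundleChartPoly (constMatrix v A)) =
      Polynomial.C (fibrePoly v A) := by
  have hs (j : Fin 4) : finSuccEquiv ℂ 4 (X j.succ) = Polynomial.C (X j) := finSuccEquiv_X_succ
  have h2 : finSuccEquiv ℂ 4 (X 2) = Polynomial.C (X 1) := hs 1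
  have h3 : finSuccEquiv ℂ 4 (X 3) = Polynomial.C (X 2) := hs 2
  have h4 : finSuccEquiv ℂ 4 (X 4) = Polynomial.C (X 3) := hs 3
  have hC (z : ℂ) : finSuccEquiv ℂ 4 (dehomP2 (C z)) = Polynomial.C (C z) := by
    rw [show dehomP2 (C z) = C z from algHom_C _ z]
    exact (finSuccEquiv ℂ 4).commutes z
  simp only [quadricBundleChartPoly, fibrePoly, constMatrix, map_sum, map_mul, hC]
  refine Finset.sum_congr rfl fun i _ => Finset.sum_congr rfl fun j _ => ?_
  fin_cases i <;> fin_cases j <;> simp [h2, h3, h4]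

theorem finSuccEquiv_quadricBundleChartPoly {A : Fin 4 → Fin 4 → MvPolynomial (Fin 3) ℂ}
    (hA : ∀ i j, (A i j).IsHomogeneous 1) :
    finSuccEquiv ℂ 4 (quadricBundleChartPoly A) =
      Polynomial.C (fibrePoly ![1, 0, 0] A) * Polynomial.X +
        Polynomial.C (fibrePoly ![0, 1, 0] A * X 0 + fibrePoly ![0, 0, 1] A) := by
  have h1 : finSuccEquiv ℂ 4 (X 1) = Polynomial.C (X 0) := finSuccEquiv_X_succ (j := 0)
  rw [quadricBundleChartPoly_of_linear hA]
  simp only [map_add, map_mul, finSuccEquiv_quadricBundleChartPoly_constMatrix, h1,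
    finSuccEquiv_X_zero]

theorem irreducible_fibrePoly {A : Fin 4 → Fin 4 → MvPolynomial (Fin 3) ℂ} {v : Fin 3 → ℂ}
    (hc : eval v (A 1 1) ≠ 0) (hA : leadingMinor (symmEval v A) ≠ 0) :
    Irreducible (fibrePoly v A) := by
  have h : Irreducible (quadricBundleChartPoly (constMatrix v A)) :=
    irreducible_quadricBundleChartPoly hc rfl (by rwa [symmEval_constMatrix])
  rw [← MulEquiv.irreducible_iff (finSuccEquiv ℂ 4),
    finSuccEquiv_quadricBundleChartPoly_constMatrix] at h
  exact h.of_map (f := Polynomial.C)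

theorem irreducible_quadricBundleChartPoly_of_linear
    {A : Fin 4 → Fin 4 → MvPolynomial (Fin 3) ℂ} (hA : ∀ i j, (A i j).IsHomogeneous 1)
    (hc : eval ![1, 0, 0] (A 1 1) ≠ 0) (hM : leadingMinor (symmEval ![1, 0, 0] A) ≠ 0)
    (hr : eval ![1, 0, 0] (A 0 0) * eval ![0, 0, 1] (A 1 1) -
      eval ![0, 0, 1] (A 0 0) * eval ![1, 0, 0] (A 1 1) ≠ 0) :
    Irreducible (quadricBundleChartPoly A) := by
  have hirr := irreducible_fibrePoly hc hM
  rw [← MulEquiv.irreducible_iff (finSuccEquiv ℂ 4), finSuccEquiv_quadricBundleChartPoly hA]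
  refine Polynomial.irreducible_C_mul_X_add_C hirr.ne_zero
    (hirr.isRelPrime_iff_not_dvd.2 fun hdvd => hr ?_)
  let π : MvPolynomial (Fin 4) ℂ →ₐ[ℂ] Polynomial ℂ := aeval ![0, Polynomial.X, 0, 0]
  have hπ (v : Fin 3 → ℂ) : π (fibrePoly v A) =
      Polynomial.C (eval v (A 1 1)) * Polynomial.X ^ 2 +
        Polynomial.C (eval v (A 0 1 + A 1 0)) * Polynomial.X + Polynomial.C (eval v (A 0 0)) := by
    simp only [π, fibrePoly, Fin.sum_univ_four, Matrix.cons_val, map_add, map_mul, aeval_C, aeval_X,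
      map_one, ← Polynomial.C_eq_algebraMap]
    ring
  obtain ⟨s, hs⟩ := map_dvd π hdvd
  have h0 : π (X 0) = 0 := by simp [π]
  rw [map_add, map_mul, h0, mul_zero, zero_add, hπ, hπ] at hs
  have hdeg : s.natDegree = 0 := by
    by_contra hne
    have hs0 : s ≠ 0 := by rintro rfl; simp at hne
    have h1 := congrArg Polynomial.natDegree hs
    have hq := Polynomial.natDegree_quadratic (b := eval ![1, 0, 0] (A 0 1 + A 1 0))
      (c := eval ![1, 0, 0] (A 0 0)) hc
    rw [Polynomial.natDegree_mul (Polynomial.ne_zero_of_natDegree_gt (n := 0) (by omega)) hs0,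
      hq] at h1
    have h2 := Polynomial.natDegree_quadratic_le (a := eval ![0, 0, 1] (A 1 1))
      (b := eval ![0, 0, 1] (A 0 1 + A 1 0)) (c := eval ![0, 0, 1] (A 0 0))
    omega
  obtain ⟨z, rfl⟩ := Polynomial.natDegree_eq_zero.1 hdeg
  have c0 := congrArg (Polynomial.coeff · 0) hs
  have c2 := congrArg (Polynomial.coeff · 2) hs
  simp [Polynomial.coeff_X, Polynomial.coeff_C] at c0 c2
  rw [c0, c2]
  ring

/-- A bundle of type `(1, 1, 1, 1)` is rational: project to the fibre coordinates. -/
theorem isRationalFunctionField_of_linear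
    {A : Fin 4 → Fin 4 → MvPolynomial (Fin 3) ℂ} (hA : ∀ i j, (A i j).IsHomogeneous 1)
    (hc : eval ![1, 0, 0] (A 1 1) ≠ 0) (hM : leadingMinor (symmEval ![1, 0, 0] A) ≠ 0)
    (hr : eval ![1, 0, 0] (A 0 0) * eval ![0, 0, 1] (A 1 1) -
      eval ![0, 0, 1] (A 0 0) * eval ![1, 0, 0] (A 1 1) ≠ 0) :
    IsRationalFunctionField (quadricBundleFFMap A) := by
  apply isRationalFunctionField_quadricBundleFFMap
  set q := quadricBundleChartPoly A with hq
  have : Fact (Irreducible q) := ⟨irreducible_quadricBundleChartPoly_of_linear hA hc hM hr⟩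
  have hL := (irreducible_fibrePoly hc hM).ne_zero
  have hdeg : (finSuccEquiv ℂ 4 q).natDegree = 1 := by
    rw [hq, finSuccEquiv_quadricBundleChartPoly hA]
    exact Polynomial.natDegree_linear hL
  set ξ := coordFun q with hξ
  set t : Fin 4 → HypersurfaceField q := fun j => ξ j.succ with ht
  set K := IntermediateField.adjoin ℂ (Set.range t) with hK
  have htK (j : Fin 4) : ξ j.succ ∈ K := IntermediateField.subset_adjoin _ _ ⟨j, rfl⟩
  set e := finSuccEquiv ℂ 4 with he
  have heX (j : Fin 4) : e (X j.succ) = Polynomial.C (X j) := finSuccEquiv_X_succ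
  have hC (g : MvPolynomial (Fin 4) ℂ) : aeval ξ (e.symm (Polynomial.C g)) = aeval t g := by
    have : ((aeval ξ).comp (e.symm : _ →ₐ[ℂ] MvPolynomial (Fin 5) ℂ)).comp
        (IsScalarTower.toAlgHom ℂ _ (Polynomial (MvPolynomial (Fin 4) ℂ))) = aeval t := by
      ext j
      have : e.symm (Polynomial.C (X j)) = X j.succ := by rw [← heX, e.symm_apply_apply]
      simp [this, ht]
    exact DFunLike.congr_fun this g
  have hCK (g : MvPolynomial (Fin 4) ℂ) : aeval t g ∈ K := aeval_mem_intermediateField htK g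
  set L := fibrePoly ![1, 0, 0] A
  set R := fibrePoly ![0, 1, 0] A * X 0 + fibrePoly ![0, 0, 1] A
  have hL0 : aeval t L ≠ 0 := by
    rw [← hC, Ne, aeval_coordFun_eq_zero]
    intro hdvd
    have h1 := Polynomial.natDegree_le_of_dvd (map_dvd e hdvd) (by simpa using hL)
    rw [e.apply_symm_apply, Polynomial.natDegree_C] at h1
    omega
  have hrel : aeval t L * ξ 0 + aeval t R = 0 := by
    have h0 : aeval ξ q = 0 := aeval_coordFun_eq_zero.2 dvd_rfl
    have hX : e.symm Polynomial.X = X 0 := by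
      rw [← (finSuccEquiv_X_zero : e (X 0) = _), e.symm_apply_apply]
    have hq' : q = e.symm (Polynomial.C L) * X 0 + e.symm (Polynomial.C R) := by
      rw [← hX, ← map_mul, ← map_add, ← finSuccEquiv_quadricBundleChartPoly hA,
        e.symm_apply_apply]
    have h0' := congrArg (aeval ξ) hq'
    rwa [h0, map_add, map_mul, hC, hC, aeval_X, eq_comm] at h0'
  refine isRationalFunctionField_hypersurface q e Fin.succ heX (by omega) t fun j => ?_
  refine Fin.cases ?_ htK j
  change ξ 0 ∈ K
  have : ξ 0 = -aeval t R / aeval t L := eq_div_of_mul_eq hL0 (by linear_combination hrel)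
  rw [this]
  exact div_mem (neg_mem (hCK _)) (hCK _)

theorem hasRationalSectionP2_of_constant {A : Fin 4 → Fin 4 → MvPolynomial (Fin 3) ℂ}
    {a b c r : ℂ} (h00 : A 0 0 = C a) (h01 : A 0 1 + A 1 0 = C b) (h11 : A 1 1 = C c)
    (hr : c * r ^ 2 + b * r + a = 0) : HasRationalSectionP2 A := by
  refine ⟨![1, algebraMap ℂ _ r, 0, 0], fun h => one_ne_zero (congrFun h 0), ?_⟩
  let φ : MvPolynomial (Fin 3) ℂ →ₐ[ℂ] FractionRing (MvPolynomial (Fin 2) ℂ) :=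
    (IsScalarTower.toAlgHom ℂ (MvPolynomial (Fin 2) ℂ) _).comp (aeval ![X 0, X 1, 1])
  change ∑ i, ∑ j, φ (A i j) * _ * _ = 0
  have hφ (z : ℂ) : φ (C z) = algebraMap ℂ _ z := φ.commutes z
  have h01' := congrArg φ h01
  have hr' := congrArg (algebraMap ℂ (FractionRing (MvPolynomial (Fin 2) ℂ))) hr
  simp only [map_add, map_mul, map_pow, map_zero, hφ] at h01' hr'
  simp only [Fin.sum_univ_four, Matrix.cons_val, h00, h11, hφ]
  linear_combination hr' + algebraMap ℂ _ r * h01'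

/-- If the restriction of the quadratic form to the first two coordinates has degree zero, then
the bundle has a section and is rational. -/
theorem hasRationalSectionP2_and_isRationalFunctionField
    {A : Fin 4 → Fin 4 → MvPolynomial (Fin 3) ℂ} (h00 : (A 0 0).IsHomogeneous 0)
    (h01 : (A 0 1 + A 1 0).IsHomogeneous 0) (h11 : (A 1 1).IsHomogeneous 0)
    (hc : eval ![0, 0, 1] (A 1 1) ≠ 0) (hM : leadingMinor (symmEval ![0, 0, 1] A) ≠ 0) :
    HasRationalSectionP2 A ∧ IsRationalFunctionField (quadricBundleFFMap A) := by
  obtain ⟨a, ha⟩ := eq_C_of_isHomogeneous_zero h00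
  obtain ⟨b, hb⟩ := eq_C_of_isHomogeneous_zero h01
  obtain ⟨c, hc'⟩ := eq_C_of_isHomogeneous_zero h11
  rw [hc', eval_C] at hc
  obtain ⟨r, hr⟩ := exists_quadratic_eq_zero (a := c) (b := b) (c := a) hc
    (IsAlgClosed.exists_eq_mul_self _)
  rw [← sq] at hr
  exact ⟨hasRationalSectionP2_of_constant ha hb hc' hr,
    isRationalFunctionField_of_constant hc ha hb hc' hr hM⟩

/-- The matrices of forms of degrees `(dᵢ + dⱼ) / 2`. -/
abbrev FormMatrix (d : Fin 4 → ℕ) : Type :=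
  Π i : Fin 4, Π j : Fin 4, homogeneousSubmodule (Fin 3) ℂ ((d i + d j) / 2)

/-- The underlying matrix of polynomials. -/
abbrev FormMatrix.toMatrix {d : Fin 4 → ℕ} (p : FormMatrix d) :
    Fin 4 → Fin 4 → MvPolynomial (Fin 3) ℂ :=
  fun i j => p i j

/-- A polynomial in the values of the entries at finitely many points is a polynomial function. -/
theorem isPolynomialFun_of_eval {d : Fin 4 → ℕ} {n : ℕ} (v : Fin n → Fin 3 → ℂ)
    {f : FormMatrix d → ℂ} (F : MvPolynomial (Fin n × Fin 4 × Fin 4) ℂ)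
    (hf : ∀ p, f p = eval (fun x => eval (v x.1) (p.toMatrix x.2.1 x.2.2)) F) :
    IsPolynomialFun f := by
  let e := Fintype.equivFin (Fin n × Fin 4 × Fin 4)
  let l (x : Fin n × Fin 4 × Fin 4) : FormMatrix d →ₗ[ℂ] ℂ :=
    (aeval (v x.1)).toLinearMap ∘ₗ (homogeneousSubmodule (Fin 3) ℂ _).subtype ∘ₗ
      LinearMap.proj x.2.2 ∘ₗ LinearMap.proj x.2.1
  refine ⟨_, fun k => l (e.symm k), rename e F, fun p => ?_⟩
  rw [hf, eval_rename]
  congr 2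
  ext x
  have hx : eval (v x.1) (p.toMatrix x.2.1 x.2.2) = l x p := by
    simp [l, aeval_eq_eval, FormMatrix.toMatrix]
  simp only [hx, Function.comp_apply, Equiv.symm_apply_apply]

/-- The genericity condition for `d₀ = d₁ = 0`. -/
noncomputable def constantCondition {d : Fin 4 → ℕ} (p : FormMatrix d) : ℂ :=
  eval ![0, 0, 1] (p.toMatrix 1 1) * leadingMinor (symmEval ![0, 0, 1] p.toMatrix)

theorem isPolynomialFun_constantCondition (d : Fin 4 → ℕ) :
    IsPolynomialFun (constantCondition (d := d)) := by
  let S (i j : Fin 4) : MvPolynomial (Fin 1 × Fin 4 × Fin 4) ℂ := X (0, i, j) + X (0, j, i)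
  refine isPolynomialFun_of_eval ![![0, 0, 1]] (X (0, 1, 1) *
    (S 0 0 * (S 1 1 * S 2 2 - S 1 2 ^ 2) - S 0 1 * (S 0 1 * S 2 2 - S 1 2 * S 0 2) +
      S 0 2 * (S 0 1 * S 1 2 - S 1 1 * S 0 2))) fun p => ?_
  simp [constantCondition, leadingMinor, symmEval, S]

theorem constantCondition_ne_zero (d : Fin 4 → ℕ) : constantCondition (d := d) ≠ 0 := by
  let p : FormMatrix d := fun i j => if i = j then ⟨X 2 ^ ((d i + d j) / 2), by
    simpa using (isHomogeneous_X ℂ (2 : Fin 3)).pow ((d i + d j) / 2)⟩ else 0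
  have hp (i j : Fin 4) : eval ![0, 0, 1] (p.toMatrix i j) = if i = j then 1 else 0 := by
    by_cases h : i = j <;> simp [FormMatrix.toMatrix, p, h]
  intro h
  have := congrFun h p
  simp only [constantCondition, leadingMinor, symmEval, map_add, hp, Pi.zero_apply] at this
  simp at this

/-- The genericity condition for `d₀ = d₁ = d₂ = d₃ = 1`. -/
noncomputable def linearCondition {d : Fin 4 → ℕ} (p : FormMatrix d) : ℂ :=
  eval ![1, 0, 0] (p.toMatrix 1 1) * leadingMinor (symmEval ![1, 0, 0] p.toMatrix) *
    (eval ![1, 0, 0] (p.toMatrix 0 0) * eval ![0, 0, 1] (p.toMatrix 1 1) -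
      eval ![0, 0, 1] (p.toMatrix 0 0) * eval ![1, 0, 0] (p.toMatrix 1 1))

theorem isPolynomialFun_linearCondition (d : Fin 4 → ℕ) :
    IsPolynomialFun (linearCondition (d := d)) := by
  let S (i j : Fin 4) : MvPolynomial (Fin 2 × Fin 4 × Fin 4) ℂ := X (0, i, j) + X (0, j, i)
  refine isPolynomialFun_of_eval ![![1, 0, 0], ![0, 0, 1]] (X (0, 1, 1) *
    (S 0 0 * (S 1 1 * S 2 2 - S 1 2 ^ 2) - S 0 1 * (S 0 1 * S 2 2 - S 1 2 * S 0 2) +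
      S 0 2 * (S 0 1 * S 1 2 - S 1 1 * S 0 2)) *
    (X (0, 0, 0) * X (1, 1, 1) - X (1, 0, 0) * X (0, 1, 1))) fun p => ?_
  simp [linearCondition, leadingMinor, symmEval, S]

theorem linearCondition_ne_zero {d : Fin 4 → ℕ} (hd : ∀ i, d i = 1) :
    linearCondition (d := d) ≠ 0 := by
  let p : FormMatrix d := fun i j =>
    if i = j then ⟨X 0 + if i = 1 then X 2 else 0, by
      rw [hd, hd, mem_homogeneousSubmodule]
      refine (isHomogeneous_X ℂ (0 : Fin 3)).add ?_
      split_ifs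
      exacts [isHomogeneous_X ℂ _, isHomogeneous_zero _ _ _]⟩ else 0
  have hp (v : Fin 3 → ℂ) (i j : Fin 4) : eval v (p.toMatrix i j) =
      if i = j then (v 0 + if i = 1 then v 2 else 0) else 0 := by
    by_cases h : i = j
    · by_cases h1 : j = 1 <;> simp [FormMatrix.toMatrix, p, h, h1]
    · simp [FormMatrix.toMatrix, p, h]
  intro h
  have := congrFun h p
  simp only [linearCondition, leadingMinor, symmEval, map_add, hp, Pi.zero_apply] at this
  simp at this

end QuadricBundle

/-!
STATEMENT 9: Let `d₀ ≤ d₁ ≤ d₂ ≤ d₃` be non-negative integers of the same parity, and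
`X → ℙ²` a very general quadric surface bundle of type `(d₀,d₁,d₂,d₃)`. If `d₁ = 0`
(equivalently `d₀ = d₁ = 0`) then `X → ℙ²` admits a (rational) section and `X` is
rational. If all `dᵢ = 1` then `X` is rational (a bidegree `(1,2)` hypersurface in
`ℙ² × ℙ³`). In particular `X` is rational whenever `∑ dᵢ ≤ 4` or `dᵢ = d_j = 0` for some
`i ≠ j`.
-/

theorem very_general_quadric_bundle_P2_rational_cases
    (d : Fin 4 → ℕ) (hmono : Monotone d) (hpar : ∀ i j, Even (d i + d j)) :
    VeryGeneral
      (P := Π i : Fin 4, Π j : Fin 4,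
        (MvPolynomial.homogeneousSubmodule (Fin 3) ℂ ((d i + d j) / 2)))
      (fun p =>
        IsQuadricBundleP2 (fun i j => (p i j : MvPolynomial (Fin 3) ℂ)) →
          -- if `d₁ = 0` then `X → ℙ²` has a section, hence `X` is rational
          (d 1 = 0 →
            HasRationalSectionP2 (fun i j => (p i j : MvPolynomial (Fin 3) ℂ)) ∧
            IsRationalFunctionField
              (quadricBundleFFMap (fun i j => (p i j : MvPolynomial (Fin 3) ℂ)))) ∧
          -- if all `dᵢ = 1` then `X` is rational
          ((∀ i, d i = 1) →
            IsRationalFunctionField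
              (quadricBundleFFMap (fun i j => (p i j : MvPolynomial (Fin 3) ℂ)))) ∧
          -- in particular, `X` is rational if `∑ dᵢ ≤ 4` or two of the `dᵢ` vanish
          ((((∑ i, d i) ≤ 4) ∨ (∃ i j, i ≠ j ∧ d i = 0 ∧ d j = 0)) →
            IsRationalFunctionField
              (quadricBundleFFMap (fun i j => (p i j : MvPolynomial (Fin 3) ℂ))))) := by
  have h0 : d 0 ≤ d 1 := hmono (by decide)
  have h2 : d 1 ≤ d 2 := hmono (by decide)
  have h3 : d 2 ≤ d 3 := hmono (by decide)
  by_cases h1 : d 1 = 0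
  · refine ⟨{QuadricBundle.constantCondition}, Set.countable_singleton _, ?_, fun p hp _ => ?_⟩
    · rintro _ rfl
      exact ⟨QuadricBundle.isPolynomialFun_constantCondition d,
        QuadricBundle.constantCondition_ne_zero d⟩
    have hp := mul_ne_zero_iff.1 (hp _ rfl)
    have hdeg (i j : Fin 4) (hi : d i = 0) (hj : d j = 0) :
        (p i j : MvPolynomial (Fin 3) ℂ).IsHomogeneous 0 := by
      simpa [hi, hj] using (MvPolynomial.mem_homogeneousSubmodule _ _).1 (p i j).2
    have hd0 : d 0 = 0 := by omega
    have h := QuadricBundle.hasRationalSectionP2_and_isRationalFunctionField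
      (hdeg 0 0 hd0 hd0) ((hdeg 0 1 hd0 h1).add (hdeg 1 0 h1 hd0)) (hdeg 1 1 h1 h1) hp.1 hp.2
    exact ⟨fun _ => h, fun _ => h.2, fun _ => h.2⟩
  by_cases hd : ∀ i, d i = 1
  · refine ⟨{QuadricBundle.linearCondition}, Set.countable_singleton _, ?_, fun p hp _ => ?_⟩
    · rintro _ rfl
      exact ⟨QuadricBundle.isPolynomialFun_linearCondition d,
        QuadricBundle.linearCondition_ne_zero hd⟩
    have hp := mul_ne_zero_iff.1 (hp _ rfl)
    have hdeg (i j : Fin 4) : (p i j : MvPolynomial (Fin 3) ℂ).IsHomogeneous 1 := by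
      simpa [hd] using (MvPolynomial.mem_homogeneousSubmodule _ _).1 (p i j).2
    have h := QuadricBundle.isRationalFunctionField_of_linear hdeg
      (mul_ne_zero_iff.1 hp.1).1 (mul_ne_zero_iff.1 hp.1).2 hp.2
    exact ⟨fun h => absurd h h1, fun _ => h, fun _ => h⟩
  refine ⟨∅, Set.countable_empty, by simp, fun p _ _ =>
    ⟨fun h => absurd h h1, fun h => absurd h hd, fun h => ?_⟩⟩
  exfalso
  rcases h with h | ⟨i, j, hij, hi, hj⟩
  · rw [Fin.sum_univ_four] at h
    have h01 := Nat.even_iff.1 (hpar 0 1)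
    have h12 := Nat.even_iff.1 (hpar 1 2)
    have h23 := Nat.even_iff.1 (hpar 2 3)
    refine hd fun i => ?_
    fin_cases i <;> simp only [Fin.zero_eta, Fin.mk_one, Fin.reduceFinMk] <;> omega
  · rcases lt_or_gt_of_ne hij with hlt | hlt
    · have := hmono (show (1 : Fin 4) ≤ j by omega)
      omega
    · have := hmono (show (1 : Fin 4) ≤ i by omega)
      omega
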